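/- (Semi-classical phase-space inequality) Let 0 < 2s < d. For every measurable function M on ℝ^d × ℝ^d with 0 ≤ M(p,x) ≤ |p|^{-2s} for all (p,x), one has ∬ |p|^{2s} M(p,x) dp dx/(2π)^d ≥ K'_{s,d} ∫ (∫ M(p,x) dp/(2π)^d)^{d/(d-2s)} dx, where K'_{s,d} = (2π)^{2ds/(d-2s)} ((d-2s)/d)^{d/(d-2s)} ω_d^{-2s/(d-2s)} and ω_d is the volume of the unit ball in ℝ^d. Moreover K'_{s,d} is optimal, with equality for M(p,x) = |p|^{-2s} χ_{{|p| < R(x)}}. -/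

import Mathlib

open MeasureTheory Real Set ENNReal Metric Module

section RadialPower

variable {E : Type*} [NormedAddCommGroup E] [NormedSpace ℝ E] [FiniteDimensional ℝ E]
  [MeasurableSpace E] [BorelSpace E] (μ : Measure E) [μ.IsAddHaarMeasure]

theorem lintegral_ball_norm_rpow_neg [Nontrivial E] {a R : ℝ} (ha : a < finrank ℝ E)
    (hR : 0 ≤ R) :
    ∫⁻ p in ball (0 : E) R, ENNReal.ofReal (‖p‖ ^ (-a)) ∂μ =
      ENNReal.ofReal (finrank ℝ E / (finrank ℝ E - a) * μ.real (ball 0 1) *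
        R ^ ((finrank ℝ E : ℝ) - a)) := by
  have hn : 1 ≤ finrank ℝ E := finrank_pos
  have he : -1 < (finrank ℝ E : ℝ) - a - 1 := by linarith
  have hpow : EqOn (fun y : ℝ => y ^ (finrank ℝ E - 1) • y ^ (-a))
      (fun y => y ^ ((finrank ℝ E : ℝ) - a - 1)) (Ioo 0 R) := by
    intro y hy
    simp only [smul_eq_mul]
    rw [← Real.rpow_natCast, ← rpow_add hy.1]
    push_cast [hn]
    congr 1
    ring
  have hint : IntegrableOn (fun p : E => ‖p‖ ^ (-a)) (ball 0 R) μ := by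
    refine (integrableOn_fun_norm_addHaar μ (f := fun y : ℝ => y ^ (-a))).2 ?_
    rw [integrableOn_congr_fun hpow measurableSet_Ioo]
    have := intervalIntegral.intervalIntegrable_rpow' (a := 0) (b := R) he
    rw [intervalIntegrable_iff_integrableOn_Ioo_of_le hR] at this
    exact this
  rw [← ofReal_integral_eq_lintegral_ofReal hint
    (ae_of_all _ fun p => rpow_nonneg (norm_nonneg p) _)]
  congr 1
  have hind : (ball (0 : E) R).indicator (fun p => ‖p‖ ^ (-a)) =
      fun p => (Iio R).indicator (fun y : ℝ => y ^ (-a)) ‖p‖ := by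
    ext p
    simp [indicator]
  rw [← integral_indicator measurableSet_ball, hind, integral_fun_norm_addHaar μ]
  have hIoi : ∫ y in Ioi (0 : ℝ),
      y ^ (finrank ℝ E - 1) • (Iio R).indicator (fun y : ℝ => y ^ (-a)) y =
        R ^ ((finrank ℝ E : ℝ) - a) / (finrank ℝ E - a) := by
    have hsmul (y : ℝ) : y ^ (finrank ℝ E - 1) • (Iio R).indicator (fun y : ℝ => y ^ (-a)) y =
        (Iio R).indicator (fun y : ℝ => y ^ (finrank ℝ E - 1) • y ^ (-a)) y :=
      (indicator_smul_apply (Iio R) (fun y : ℝ => y ^ (finrank ℝ E - 1)) _ y).symm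
    simp_rw [hsmul]
    rw [setIntegral_indicator measurableSet_Iio, Ioi_inter_Iio,
      setIntegral_congr_fun measurableSet_Ioo hpow, ← integral_Ioc_eq_integral_Ioo,
      ← intervalIntegral.integral_of_le hR, integral_rpow (Or.inl he), sub_add_cancel,
      zero_rpow (by linarith), sub_zero]
  rw [hIoi, nsmul_eq_mul, smul_eq_mul]
  ring

/-- The bathtub principle for densities bounded by `‖p‖ ^ (-a)`. -/
theorem measure_ball_le_lintegral_norm_rpow_mul [Nontrivial E] {a R : ℝ} (ha₀ : 0 ≤ a)
    (ha : a < finrank ℝ E) (hR : 0 ≤ R) {m : E → ℝ} (hm : Measurable m)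
    (hm₀ : ∀ p, 0 ≤ m p) (hm₁ : ∀ p, m p ≤ ‖p‖ ^ (-a))
    (h : ∫⁻ p in ball (0 : E) R, ENNReal.ofReal (‖p‖ ^ (-a)) ∂μ ≤
      ∫⁻ p, ENNReal.ofReal (m p) ∂μ) :
    μ (ball 0 R) ≤ ∫⁻ p, ENNReal.ofReal (‖p‖ ^ a * m p) ∂μ := by
  set A := ∫⁻ p in ball (0 : E) R, ENNReal.ofReal (‖p‖ ^ (-a)) ∂μ with hA
  have hAtop : ENNReal.ofReal (R ^ a) * A ≠ ∞ := by
    rw [hA, lintegral_ball_norm_rpow_neg μ ha hR]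
    finiteness
  have hpt : ∀ᵐ p ∂μ, (ball (0 : E) R).indicator 1 p + ENNReal.ofReal (R ^ a) *
      ENNReal.ofReal (m p) ≤ ENNReal.ofReal (‖p‖ ^ a * m p) + ENNReal.ofReal (R ^ a) *
        (ball (0 : E) R).indicator (fun p => ENNReal.ofReal (‖p‖ ^ (-a))) p := by
    filter_upwards [Measure.ae_ne μ (0 : E)] with p hp
    have hp' : 0 < ‖p‖ := norm_pos_iff.2 hp
    have hRa : 0 ≤ R ^ a := rpow_nonneg hR a
    have hpa : 0 ≤ ‖p‖ ^ a := rpow_nonneg hp'.le a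
    have hinv : ‖p‖ ^ a * ‖p‖ ^ (-a) = 1 := by rw [← rpow_add hp', add_neg_cancel, Real.rpow_zero]
    by_cases hpR : p ∈ ball (0 : E) R
    · rw [indicator_of_mem hpR, indicator_of_mem hpR, Pi.one_apply, ← ofReal_one,
        ← ofReal_mul hRa, ← ofReal_mul hRa, ← ofReal_add zero_le_one
          (mul_nonneg hRa (hm₀ p)), ← ofReal_add (mul_nonneg hpa (hm₀ p)) (by positivity)]
      have hle : ‖p‖ ^ a ≤ R ^ a :=
        rpow_le_rpow hp'.le (mem_ball_zero_iff.1 hpR).le ha₀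
      apply ofReal_le_ofReal
      nlinarith [mul_nonneg (sub_nonneg.2 hle) (sub_nonneg.2 (hm₁ p))]
    · rw [indicator_of_notMem hpR, indicator_of_notMem hpR, zero_add, mul_zero, add_zero,
        ← ofReal_mul hRa]
      have hle : R ^ a ≤ ‖p‖ ^ a :=
        rpow_le_rpow hR (not_lt.1 fun h => hpR (mem_ball_zero_iff.2 h)) ha₀
      exact ofReal_le_ofReal (mul_le_mul_of_nonneg_right hle (hm₀ p))
  have hsum := lintegral_mono_ae hpt
  rw [lintegral_add_left (measurable_one.indicator measurableSet_ball),
    lintegral_add_left (by fun_prop), lintegral_const_mul _ (by fun_prop),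
    lintegral_const_mul _ ((by fun_prop : Measurable _).indicator measurableSet_ball),
    lintegral_indicator_one measurableSet_ball,
    lintegral_indicator measurableSet_ball, ← hA] at hsum
  refine (ENNReal.add_le_add_iff_right hAtop).1 (le_trans ?_ hsum)
  gcongr

theorem lintegral_norm_rpow_mul_indicator_ball [Nontrivial E] (a R : ℝ) :
    ∫⁻ p, ENNReal.ofReal (‖p‖ ^ a * if ‖p‖ < R then ‖p‖ ^ (-a) else 0) ∂μ =
      μ (ball 0 R) := by
  rw [← lintegral_indicator_one measurableSet_ball]
  refine lintegral_congr_ae ?_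
  filter_upwards [Measure.ae_ne μ (0 : E)] with p hp
  have hinv : ‖p‖ ^ a * ‖p‖ ^ (-a) = 1 := by
    rw [← rpow_add (norm_pos_iff.2 hp), add_neg_cancel, Real.rpow_zero]
  by_cases hpR : ‖p‖ < R <;> simp [indicator, hpR, hinv]

end RadialPower

/-- The optimal constant of the phase-space inequality in terms of the dimension `d`, the
exponent `s` and the volume `ω` of the unit ball. -/
noncomputable def phaseSpaceConst (d s ω : ℝ) : ℝ :=
  (2 * π) ^ (2 * d * s / (d - 2 * s)) * ((d - 2 * s) / d) ^ (d / (d - 2 * s)) *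
    ω ^ (-(2 * s) / (d - 2 * s))

theorem phaseSpaceConst_pos {d s ω : ℝ} (hd : 0 < d) (hsd : 2 * s < d) (hω : 0 < ω) :
    0 < phaseSpaceConst d s ω := by
  have he : 0 < d - 2 * s := sub_pos.2 hsd
  unfold phaseSpaceConst
  positivity

theorem phaseSpaceConst_mul_rpow {d s ω R : ℝ} (hd : 0 < d) (hsd : 2 * s < d) (hω : 0 < ω)
    (hR : 0 ≤ R) :
    phaseSpaceConst d s ω * ((2 * π) ^ (-d) * (d / (d - 2 * s) * ω * R ^ (d - 2 * s))) ^
      (d / (d - 2 * s)) = (2 * π) ^ (-d) * (R ^ d * ω) := by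
  have he : 0 < d - 2 * s := sub_pos.2 hsd
  have hπ : 0 < 2 * π := by positivity
  rw [phaseSpaceConst]
  generalize 2 * π = c at *
  rw [mul_rpow (by positivity) (by positivity),
    mul_rpow (by positivity) (by positivity), mul_rpow (by positivity) hω.le, ← rpow_mul hR,
    ← rpow_mul hπ.le, mul_div_cancel₀ d he.ne']
  have h₁ : c ^ (2 * d * s / (d - 2 * s)) * c ^ (-d * (d / (d - 2 * s))) =
      c ^ (-d) := by
    rw [← rpow_add hπ]
    congr 1
    field_simp
    ring
  have h₂ : ((d - 2 * s) / d) ^ (d / (d - 2 * s)) * (d / (d - 2 * s)) ^ (d / (d - 2 * s)) =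
      1 := by
    rw [← mul_rpow (by positivity) (by positivity), div_mul_div_cancel₀ hd.ne', div_self he.ne',
      Real.one_rpow]
  have h₃ : ω ^ (-(2 * s) / (d - 2 * s)) * ω ^ (d / (d - 2 * s)) = ω := by
    rw [← rpow_add hω, ← add_div, neg_add_eq_sub, div_self he.ne', Real.rpow_one]
  calc _ = (c ^ (2 * d * s / (d - 2 * s)) * c ^ (-d * (d / (d - 2 * s)))) *
        (((d - 2 * s) / d) ^ (d / (d - 2 * s)) * (d / (d - 2 * s)) ^ (d / (d - 2 * s))) *
        (ω ^ (-(2 * s) / (d - 2 * s)) * ω ^ (d / (d - 2 * s))) * R ^ d := by ring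
    _ = _ := by rw [h₁, h₂, h₃]; ring

section PhaseSpace

variable {d : ℕ} {s : ℝ}

theorem phaseSpaceConst_mul_lintegral_ball_rpow (hd : 0 < d) (hsd : 2 * s < d) {R : ℝ}
    (hR : 0 ≤ R) :
    ENNReal.ofReal (phaseSpaceConst d s (volume (ball (0 : EuclideanSpace ℝ (Fin d)) 1)).toReal) *
        (ENNReal.ofReal ((2 * π) ^ (-(d : ℝ))) *
          ∫⁻ p in ball (0 : EuclideanSpace ℝ (Fin d)) R, ENNReal.ofReal (‖p‖ ^ (-(2 * s)))) ^
            ((d : ℝ) / ((d : ℝ) - 2 * s)) =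
      ENNReal.ofReal ((2 * π) ^ (-(d : ℝ))) *
        volume (ball (0 : EuclideanSpace ℝ (Fin d)) R) := by
  have : NeZero d := ⟨hd.ne'⟩
  have hd' : (0 : ℝ) < d := Nat.cast_pos.2 hd
  have he : 0 < (d : ℝ) - 2 * s := sub_pos.2 hsd
  have hω : 0 < (volume (ball (0 : EuclideanSpace ℝ (Fin d)) 1)).toReal :=
    toReal_pos (measure_ball_pos _ _ one_pos).ne' measure_ball_lt_top.ne
  have hvol : volume (ball (0 : EuclideanSpace ℝ (Fin d)) R) =
      ENNReal.ofReal (R ^ (d : ℝ) * (volume (ball (0 : EuclideanSpace ℝ (Fin d)) 1)).toReal) := by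
    rw [Measure.addHaar_ball _ _ hR, finrank_euclideanSpace_fin, ofReal_mul (by positivity),
      ofReal_toReal measure_ball_lt_top.ne, Real.rpow_natCast]
  rw [lintegral_ball_norm_rpow_neg volume (by simpa using hsd) hR, finrank_euclideanSpace_fin,
    hvol, ← ofReal_mul (by positivity), ← ofReal_mul (by positivity),
    ofReal_rpow_of_nonneg (by unfold Measure.real; positivity) (by positivity),
    ← ofReal_mul (phaseSpaceConst_pos hd' hsd hω).le]
  exact congrArg _ (phaseSpaceConst_mul_rpow hd' hsd hω hR)

theorem phaseSpaceConst_mul_lintegral_rpow_le (hd : 0 < d) (hs : 0 < s) (hsd : 2 * s < d)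
    {m : EuclideanSpace ℝ (Fin d) → ℝ} (hm : Measurable m) (hm₀ : ∀ p, 0 ≤ m p)
    (hm₁ : ∀ p, m p ≤ ‖p‖ ^ (-(2 * s))) :
    ENNReal.ofReal (phaseSpaceConst d s (volume (ball (0 : EuclideanSpace ℝ (Fin d)) 1)).toReal) *
        (ENNReal.ofReal ((2 * π) ^ (-(d : ℝ))) * ∫⁻ p, ENNReal.ofReal (m p)) ^
            ((d : ℝ) / ((d : ℝ) - 2 * s)) ≤
      ENNReal.ofReal ((2 * π) ^ (-(d : ℝ))) * ∫⁻ p, ENNReal.ofReal (‖p‖ ^ (2 * s) * m p) := by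
  have : NeZero d := ⟨hd.ne'⟩
  have hd' : (0 : ℝ) < d := Nat.cast_pos.2 hd
  have he : 0 < (d : ℝ) - 2 * s := sub_pos.2 hsd
  have hω : 0 < (volume (ball (0 : EuclideanSpace ℝ (Fin d)) 1)).toReal :=
    toReal_pos (measure_ball_pos _ _ one_pos).ne' measure_ball_lt_top.ne
  have ha : 2 * s < finrank ℝ (EuclideanSpace ℝ (Fin d)) := by simpa using hsd
  have hbath {R : ℝ} (hR : 0 ≤ R) := measure_ball_le_lintegral_norm_rpow_mul
    (volume : Measure (EuclideanSpace ℝ (Fin d))) (by positivity) ha hR hm hm₀ hm₁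
  by_cases hA : ∫⁻ p, ENNReal.ofReal (m p) = ∞
  · have htop : ∫⁻ p, ENNReal.ofReal (‖p‖ ^ (2 * s) * m p) = ∞ := by
      have hn (n : ℕ) := hbath (R := n) n.cast_nonneg (by rw [hA]; exact le_top)
      rw [← top_le_iff, ← measure_univ_of_isAddLeftInvariant
        (volume : Measure (EuclideanSpace ℝ (Fin d))), ← iUnion_ball_nat 0]
      rw [Monotone.measure_iUnion fun i j hij => ball_subset_ball (Nat.cast_le.2 hij)]
      exact iSup_le hn
    rw [htop, mul_top (ofReal_pos.2 (by positivity)).ne']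
    exact le_top
  · obtain ⟨R, hR, hRA⟩ : ∃ R, 0 ≤ R ∧ ∫⁻ p in ball (0 : EuclideanSpace ℝ (Fin d)) R,
        ENNReal.ofReal (‖p‖ ^ (-(2 * s))) = ∫⁻ p, ENNReal.ofReal (m p) := by
      set A := ∫⁻ p, ENNReal.ofReal (m p)
      set b : ℝ := d / (d - 2 * s) * (volume (ball (0 : EuclideanSpace ℝ (Fin d)) 1)).toReal
      have hb : 0 < b := by positivity
      refine ⟨(A.toReal / b) ^ ((d : ℝ) - 2 * s)⁻¹, by positivity, ?_⟩
      rw [lintegral_ball_norm_rpow_neg volume ha (by positivity), finrank_euclideanSpace_fin,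
        rpow_inv_rpow (by positivity) he.ne']
      change ENNReal.ofReal (b * (A.toReal / b)) = A
      rw [mul_div_cancel₀ _ hb.ne', ofReal_toReal hA]
    rw [← hRA, phaseSpaceConst_mul_lintegral_ball_rpow hd hsd hR]
    gcongr
    exact hbath hR hRA.le

end PhaseSpace

/-- Semi-classical phase-space inequality: let `0 < 2s < d`. For every measurable
`M : ℝ^d × ℝ^d → ℝ` (variables `(p,x)`) with `0 ≤ M(p,x) ≤ |p|^{-2s}`, one has
`∬ |p|^{2s} M(p,x) dp dx/(2π)^d ≥ K'_{s,d} ∫ (∫ M(p,x) dp/(2π)^d)^{d/(d-2s)} dx`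
with `K'_{s,d} = (2π)^{2ds/(d-2s)} ((d-2s)/d)^{d/(d-2s)} ω_d^{-2s/(d-2s)}`, where `ω_d`
is the volume of the unit ball of `ℝ^d`. Moreover `K'_{s,d}` is optimal: equality holds
for the bathtub functions `M(p,x) = |p|^{-2s} χ_{{|p| < R(x)}}`. -/
theorem phase_space_inequality {d : ℕ} {s : ℝ} (hd : 0 < d) (hs : 0 < s)
    (hsd : 2 * s < d) :
    ∀ K' : ℝ, K' = (2 * π) ^ (2 * (d : ℝ) * s / ((d : ℝ) - 2 * s)) *
        (((d : ℝ) - 2 * s) / (d : ℝ)) ^ ((d : ℝ) / ((d : ℝ) - 2 * s)) *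
        ((volume (Metric.ball (0 : EuclideanSpace ℝ (Fin d)) 1)).toReal)
          ^ (-(2 * s) / ((d : ℝ) - 2 * s)) →
    (∀ M : EuclideanSpace ℝ (Fin d) × EuclideanSpace ℝ (Fin d) → ℝ,
      Measurable M → (∀ q, 0 ≤ M q ∧ M q ≤ ‖q.1‖ ^ (-(2 * s))) →
      ENNReal.ofReal K' *
          ∫⁻ x, (ENNReal.ofReal ((2 * π) ^ (-(d : ℝ))) *
              ∫⁻ p, ENNReal.ofReal (M (p, x)))
            ^ ((d : ℝ) / ((d : ℝ) - 2 * s))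
        ≤ ENNReal.ofReal ((2 * π) ^ (-(d : ℝ))) *
            ∫⁻ q, ENNReal.ofReal (‖q.1‖ ^ (2 * s) * M q))
    ∧ ∀ R : EuclideanSpace ℝ (Fin d) → ℝ, Measurable R → (∀ x, 0 ≤ R x) →
      ∀ M : EuclideanSpace ℝ (Fin d) × EuclideanSpace ℝ (Fin d) → ℝ,
      (∀ q, M q = if ‖q.1‖ < R q.2 then ‖q.1‖ ^ (-(2 * s)) else 0) →
      ENNReal.ofReal K' *
          ∫⁻ x, (ENNReal.ofReal ((2 * π) ^ (-(d : ℝ))) *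
              ∫⁻ p, ENNReal.ofReal (M (p, x)))
            ^ ((d : ℝ) / ((d : ℝ) - 2 * s))
        = ENNReal.ofReal ((2 * π) ^ (-(d : ℝ))) *
            ∫⁻ q, ENNReal.ofReal (‖q.1‖ ^ (2 * s) * M q) := by
  rintro K' hK'
  have hK : K' = phaseSpaceConst d s
      (volume (ball (0 : EuclideanSpace ℝ (Fin d)) 1)).toReal := hK'
  subst hK
  clear hK'
  have : NeZero d := ⟨hd.ne'⟩
  have htonelli {M : EuclideanSpace ℝ (Fin d) × EuclideanSpace ℝ (Fin d) → ℝ}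
      (hM : Measurable M) : ENNReal.ofReal ((2 * π) ^ (-(d : ℝ))) *
        ∫⁻ q, ENNReal.ofReal (‖q.1‖ ^ (2 * s) * M q) =
      ∫⁻ x, ENNReal.ofReal ((2 * π) ^ (-(d : ℝ))) *
        ∫⁻ p, ENNReal.ofReal (‖p‖ ^ (2 * s) * M (p, x)) := by
    rw [lintegral_const_mul' _ _ ofReal_ne_top, Measure.volume_eq_prod,
      lintegral_prod_symm' _ (by fun_prop)]
  refine ⟨fun M hM hMb => ?_, fun R hR hR₀ M hMR => ?_⟩
  · rw [htonelli hM, ← lintegral_const_mul' _ _ ofReal_ne_top]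
    exact lintegral_mono fun x => phaseSpaceConst_mul_lintegral_rpow_le hd hs hsd
      (by fun_prop) (fun p => (hMb (p, x)).1) fun p => (hMb (p, x)).2
  · have hM : Measurable M := by
      rw [funext hMR]
      exact Measurable.ite (measurableSet_lt (by fun_prop) (by fun_prop)) (by fun_prop)
        measurable_const
    rw [htonelli hM, ← lintegral_const_mul' _ _ ofReal_ne_top]
    refine lintegral_congr fun x => ?_
    have hball : ∫⁻ p, ENNReal.ofReal (M (p, x)) =
        ∫⁻ p in ball (0 : EuclideanSpace ℝ (Fin d)) (R x),
          ENNReal.ofReal (‖p‖ ^ (-(2 * s))) := by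
      rw [← lintegral_indicator measurableSet_ball]
      refine lintegral_congr fun p => ?_
      by_cases hp : ‖p‖ < R x <;> simp [hMR, indicator, hp]
    simp_rw [hball, hMR, lintegral_norm_rpow_mul_indicator_ball]
    exact phaseSpaceConst_mul_lintegral_ball_rpow hd hsd (hR₀ x)
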